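/- Let κ be a field and s ∈ κ with s ≠ 0. For each i ∈ ℤ let (x_i : y_i) be a point of ℙ¹(κ), and assume there exist indices i, j ∈ ℤ with x_i ≠ 0 and y_j ≠ 0. Suppose x_i·y_j = s^{j−i}·y_i·x_j for all pairs i < j. Then x_i ≠ 0 and y_i ≠ 0 for every i ∈ ℤ, and x_i/y_i = s^{−i}·(x_0/y_0) for every i ∈ ℤ; in particular the family is uniquely determined by the element x_0/y_0 of κ∖{0}, so the solution set is in bijection with κ∖{0}. -/

import Mathlib

/-- The relations `x_i y_j = s^{j-i} y_i x_j` for `i < j` imply them for all pairs `i`, `j`. -/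
theorem mul_eq_zpow_sub_mul_of_lt {κ : Type*} [Field κ] {s : κ} (hs : s ≠ 0) {x y : ℤ → κ}
    (heq : ∀ i j : ℤ, i < j → x i * y j = s ^ (j - i) * (y i * x j)) (i j : ℤ) :
    x i * y j = s ^ (j - i) * (y i * x j) := by
  rcases lt_trichotomy i j with h | rfl | h
  · exact heq i j h
  · simp [mul_comm]
  · rw [mul_comm (y i), heq j i h, ← mul_assoc, ← zpow_add₀ hs]
    simp [mul_comm]

/-- a doubly infinite family of points `(x_i : y_i)` of `ℙ¹(κ)`
satisfying `x_i y_j = s^{j-i} y_i x_j` for all `i < j` (with `s ≠ 0`), and not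
all `(0:1)` nor all `(1:0)`, has all coordinates nonzero and satisfies
`x_i/y_i = s^{-i}·(x_0/y_0)`. -/
theorem torus_fiber_of_chain_degeneration (κ : Type) [Field κ]
    (s : κ) (hs : s ≠ 0)
    (x y : ℤ → κ) (hpt : ∀ i, ¬(x i = 0 ∧ y i = 0))
    (hx : ∃ i, x i ≠ 0) (hy : ∃ j, y j ≠ 0)
    (heq : ∀ i j : ℤ, i < j → x i * y j = s ^ (j - i) * (y i * x j)) :
    (∀ i : ℤ, x i ≠ 0 ∧ y i ≠ 0) ∧
      (∀ i : ℤ, x i / y i = s ^ (-i) * (x 0 / y 0)) := by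
  have key := mul_eq_zpow_sub_mul_of_lt hs heq
  have hne : ∀ i : ℤ, x i ≠ 0 ∧ y i ≠ 0 := by
    intro i
    constructor
    · intro h
      obtain ⟨j, hj⟩ := hx
      have hyi : y i ≠ 0 := fun h' => hpt i ⟨h, h'⟩
      have hji := key j i
      rw [h, mul_zero, mul_zero] at hji
      exact mul_ne_zero hj hyi hji
    · intro h
      obtain ⟨j, hj⟩ := hy
      have hxi : x i ≠ 0 := fun h' => hpt i ⟨h', h⟩
      have hij := key i j
      rw [h, zero_mul, mul_zero] at hij
      exact mul_ne_zero hxi hj hij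
  refine ⟨hne, fun i => ?_⟩
  have h := key i 0
  rw [zero_sub] at h
  rw [← mul_div_assoc, div_eq_div_iff (hne i).2 (hne 0).2, h]
  ring
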